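/- Let λ and μ be partitions and let τ ≥ 0 and k be integers with 0 ≤ k ≤ μ_1. Then θ_k(λ, μ) (the ε = − construction) belongs to Θ^{−,τ}_k(λ, μ); that is, writing [M'; L'] = θ_k(λ, μ), one has μ_i ≥ M'_i ≥ μ_{i+1} and L'_i ≥ λ_i ≥ L'_{i+1} for all i ≥ 1, ‖M'‖ = ‖μ‖ − k, and ‖L'‖ = ‖λ‖ + τ + k. -/

import Mathlib

/-- The weakly decreasing rearrangement of a weakly decreasing sequence `f`
with one extra part `t` inserted. -/
def insertPart (t : ℕ) (f : ℕ → ℕ) : ℕ → ℕ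
  | 0 => max (f 0) t
  | n + 1 => max (min (f n) t) (f (n + 1))

/-- A partition: a weakly decreasing sequence of naturals with
finitely many nonzero terms. -/
def IsPartition (f : ℕ → ℕ) : Prop := Antitone f ∧ ∃ N, ∀ n, N ≤ n → f n = 0

/-- The size `‖f‖` of a partition: the sum of its parts. -/
noncomputable def psize (f : ℕ → ℕ) : ℕ := ∑ᶠ n, f n

/-- Membership of the bipartition `[M; L]` in `Θ^{+,τ}_k(λ,μ)`:
`M_i ≥ μ_i ≥ M_{i+1}`, `λ_i ≥ L_i ≥ λ_{i+1}` for all `i`, with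
`‖M‖ = ‖μ‖ + τ + k` and `‖L‖ = ‖λ‖ - k`.  (All sequences are 0-indexed.) -/
def ThetaPlusMem (τ k : ℕ) (lam mu M L : ℕ → ℕ) : Prop :=
  IsPartition M ∧ IsPartition L ∧
  (∀ i, mu i ≤ M i ∧ M (i + 1) ≤ mu i) ∧
  (∀ i, L i ≤ lam i ∧ lam (i + 1) ≤ L i) ∧
  psize M = psize mu + τ + k ∧ psize L + k = psize lam

/-- Membership of the bipartition `[M; L]` in `Θ^{-,τ}_k(λ,μ)`:
`μ_i ≥ M_i ≥ μ_{i+1}`, `L_i ≥ λ_i ≥ L_{i+1}` for all `i`, with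
`‖M‖ = ‖μ‖ - k` and `‖L‖ = ‖λ‖ + τ + k`.  (All sequences are 0-indexed.) -/
def ThetaMinusMem (τ k : ℕ) (lam mu M L : ℕ → ℕ) : Prop :=
  IsPartition M ∧ IsPartition L ∧
  (∀ i, M i ≤ mu i ∧ mu (i + 1) ≤ M i) ∧
  (∀ i, lam i ≤ L i ∧ L (i + 1) ≤ lam i) ∧
  psize M + k = psize mu ∧ psize L = psize lam + τ + k

/-- Lexicographic order on sequences: `f` strictly precedes `g`. -/
def LexLt (f g : ℕ → ℕ) : Prop := ∃ i, (∀ j, j < i → f j = g j) ∧ f i < g i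

theorem psize_eq_sum_range {f : ℕ → ℕ} {N : ℕ} (hf : ∀ n, N ≤ n → f n = 0) :
    psize f = ∑ n ∈ Finset.range N, f n := by
  refine finsum_eq_sum_of_support_subset f fun n hn => ?_
  by_contra h
  exact hn (hf n (by simpa using h))

theorem sum_range_insertPart {f : ℕ → ℕ} (hf : Antitone f) (t n : ℕ) :
    ∑ i ∈ Finset.range (n + 1), insertPart t f i + min (f n) t =
      ∑ i ∈ Finset.range (n + 1), f i + t := by
  induction n with
  | zero => simp [insertPart, max_add_min]
  | succ n ih =>
    have h := hf (Nat.le_add_right n 1)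
    rw [Finset.sum_range_succ, Finset.sum_range_succ f, insertPart]
    omega

theorem insertPart_eq_zero {t N : ℕ} {f : ℕ → ℕ} (hf : ∀ n, N ≤ n → f n = 0) (n : ℕ)
    (hn : N + 1 ≤ n) : insertPart t f n = 0 := by
  obtain ⟨m, rfl⟩ : ∃ m, n = m + 1 := ⟨n - 1, by omega⟩
  simp [insertPart, hf m (by omega), hf (m + 1) (by omega)]

theorem IsPartition.insertPart {f : ℕ → ℕ} (hf : IsPartition f) (t : ℕ) :
    IsPartition (insertPart t f) := by
  obtain ⟨hanti, N, hN⟩ := hf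
  refine ⟨antitone_nat_of_succ_le fun n => ?_, N + 1, insertPart_eq_zero hN⟩
  cases n with
  | zero =>
    have := hanti (Nat.le_add_right 0 1)
    simp only [_root_.insertPart]
    omega
  | succ n =>
    have h₁ := hanti (Nat.le_add_right n 1)
    have h₂ := hanti (Nat.le_add_right (n + 1) 1)
    simp only [_root_.insertPart]
    omega

theorem IsPartition.psize_insertPart {f : ℕ → ℕ} (hf : IsPartition f) (t : ℕ) :
    psize (_root_.insertPart t f) = psize f + t := by
  obtain ⟨hanti, N, hN⟩ := hf
  rw [psize_eq_sum_range (insertPart_eq_zero hN),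
    psize_eq_sum_range fun n hn => hN n (N.le_succ.trans hn)]
  simpa [hN N le_rfl] using sum_range_insertPart hanti t N

theorem le_insertPart (t : ℕ) (f : ℕ → ℕ) (n : ℕ) : f n ≤ insertPart t f n := by
  cases n <;> simp [insertPart]

theorem insertPart_succ_le {f : ℕ → ℕ} (hf : Antitone f) (t n : ℕ) :
    insertPart t f (n + 1) ≤ f n :=
  max_le (min_le_left _ _) (hf n.le_succ)

theorem IsPartition.tail {f : ℕ → ℕ} (hf : IsPartition f) :
    IsPartition fun n => f (n + 1) := by
  obtain ⟨hanti, N, hN⟩ := hf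
  exact ⟨fun a b h => hanti (Nat.succ_le_succ h), N, fun n hn => hN _ (by omega)⟩

theorem IsPartition.psize_tail_add_head {f : ℕ → ℕ} (hf : IsPartition f) :
    psize (fun n => f (n + 1)) + f 0 = psize f := by
  obtain ⟨-, N, hN⟩ := hf
  rw [psize_eq_sum_range (N := N) fun n hn => hN (n + 1) (by omega),
    psize_eq_sum_range (N := N + 1) fun n hn => hN n (by omega), Finset.sum_range_succ']

/-- The ε = - construction `θ_k(λ,μ)` belongs to `Θ^{-,τ}_k(λ,μ)`. -/
theorem stmt3 (τ k : ℕ) (lam mu : ℕ → ℕ)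
    (hlam : IsPartition lam) (hmu : IsPartition mu) (hk : k ≤ mu 0) :
    ThetaMinusMem τ k lam mu (insertPart (mu 0 - k) fun n => mu (n + 1))
      (insertPart (τ + k) lam) := by
  refine ⟨hmu.tail.insertPart _, hlam.insertPart _,
    fun i => ⟨?_, le_insertPart _ (fun n => mu (n + 1)) i⟩,
    fun i => ⟨le_insertPart _ _ i, insertPart_succ_le hlam.1 _ i⟩, ?_, ?_⟩
  · cases i with
    | zero => exact max_le (hmu.1 (Nat.le_succ 0)) (Nat.sub_le _ _)
    | succ i => exact insertPart_succ_le hmu.tail.1 _ i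
  · rw [hmu.tail.psize_insertPart, ← hmu.psize_tail_add_head]
    omega
  · rw [hlam.psize_insertPart, add_assoc]
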